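/- Let L be a finite extension of the rational function field 𝔽_q(θ), let n ≥ 1, and let P_1,…,P_ℓ ∈ C^{⊗n}(L) with associated polynomials f_i := f_{P_i} ∈ L[t]. Suppose: (1) f_1,…,f_ℓ are linearly independent over 𝔽_q[t], i.e., the only tuple (a_1,…,a_ℓ) ∈ 𝔽_q[t]^ℓ with a_1 f_1 + ⋯ + a_ℓ f_ℓ = 0 in L[t] is the zero tuple; (2) ord_v(f_i) > 0 for all 1 ≤ i ≤ ℓ and every infinite place v of L; (3) ord_v(f_i) ≥ 1 − q for all 1 ≤ i ≤ ℓ and every finite place v of L. Then P_1,…,P_ℓ are linearly independent over 𝔽_q[t]: if a_1·P_1 + ⋯ + a_ℓ·P_ℓ = 0 in C^{⊗n}(L) with a_i ∈ 𝔽_q[t], then all a_i = 0. -/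

import Mathlib

open Polynomial

/-- The `t`-action `φ` on the `n`-th tensor power of the Carlitz module:
`φ(x_1,…,x_n) = (θx_1+x_2, …, θx_{n−1}+x_n, θx_n + x_1^q)`. -/
def carlitzPhi {L : Type*} [Field L] (q n : ℕ) (θ : L) (x : Fin n → L) : Fin n → L :=
  fun i => θ * x i +
    if h : (i : ℕ) + 1 < n then x ⟨(i : ℕ) + 1, h⟩
    else (x ⟨0, Nat.lt_of_le_of_lt (Nat.zero_le _) i.isLt⟩) ^ q

/-- The action of `a ∈ 𝔽_q[t]` on `C^{⊗n}(L)`, namely `a(φ)` applied to `x`; the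
coefficients of `a` act through the ring homomorphism `χ : Fq →+* L`. -/
def carlitzAct {Fq L : Type*} [Field Fq] [Field L] (q n : ℕ) (θ : L) (χ : Fq →+* L)
    (a : Polynomial Fq) (x : Fin n → L) : Fin n → L :=
  ∑ i ∈ Finset.range (a.natDegree + 1), χ (a.coeff i) • (carlitzPhi q n θ)^[i] x

/-- The polynomial `f_P = p_0 + p_1(t−θ) + ⋯ + p_{n−1}(t−θ)^{n−1}` associated to the point
`P = (p_{n−1},…,p_0)` (so `P i.rev` is `p_i`). -/
noncomputable def assocPoly {L : Type*} [Field L] (n : ℕ) (θ : L) (P : Fin n → L) :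
    Polynomial L :=
  ∑ i : Fin n, Polynomial.C (P i.rev) * (Polynomial.X - Polynomial.C θ) ^ (i : ℕ)

/-- An additive valuation on a field `K`: a map `v : K → ℤ ∪ {∞}` with `v x = ∞` iff `x = 0`,
`v(xy) = v x + v y` and `v(x+y) ≥ min (v x) (v y)`. -/
structure AddVal (K : Type*) [Field K] where
  v : K → WithTop ℤ
  eq_top_iff : ∀ x, v x = ⊤ ↔ x = 0
  map_mul : ∀ x y, v (x * y) = v x + v y
  add_le : ∀ x y, min (v x) (v y) ≤ v (x + y)

/-- `ord_v` of a polynomial: the minimum of `v` over its coefficients (`∞` for `0`). -/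
noncomputable def ordv {K : Type*} [Field K] (w : AddVal K) (h : Polynomial K) : WithTop ℤ :=
  (Finset.range (h.natDegree + 1)).inf fun i => w.v (h.coeff i)

/-- `ord_v` of a point of `C^{⊗n}`: the minimum of `v` over its coordinates. -/
noncomputable def ordPt {K : Type*} [Field K] {n : ℕ} (w : AddVal K) (P : Fin n → K) :
    WithTop ℤ :=
  Finset.univ.inf fun i => w.v (P i)

/-- A place of a finite extension `L` of the rational function field `𝔽_q(θ)`: an additive
valuation on `L` that vanishes on all nonzero constants from `𝔽_q` and attains the value `1`. -/
structure Place (Fq L : Type*) [Field Fq] [Field L] [Algebra (RatFunc Fq) L] extends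
    AddVal L where
  const_zero : ∀ c : Fq, c ≠ 0 →
    v (algebraMap (RatFunc Fq) L (algebraMap Fq (RatFunc Fq) c)) = 0
  exists_one : ∃ x : L, v x = 1

/-- The element `θ` of `L`, i.e. the image in `L` of the variable of `𝔽_q(θ)`. -/
noncomputable def thetaL (Fq L : Type*) [Field Fq] [Field L] [Algebra (RatFunc Fq) L] : L :=
  algebraMap (RatFunc Fq) L RatFunc.X

/-- The canonical ring homomorphism `𝔽_q → L`. -/
noncomputable def constMap (Fq L : Type*) [Field Fq] [Field L] [Algebra (RatFunc Fq) L] :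
    Fq →+* L :=
  (algebraMap (RatFunc Fq) L).comp (algebraMap Fq (RatFunc Fq))


theorem norm_addval {L : Type*} [Field L] (u : Valuation L (WithZero (Multiplicative ℤ))) (z : L) (hz : z ≠ 0)
    (huz : u z < 1) : ∃ w : AddVal L, (∃ x, w.v x = 1) ∧ (∀ x, u x ≤ 1 → 0 ≤ w.v x) ∧
      (∀ x, u x < 1 → 0 < w.v x) := by
  classical
  have hu0 : ∀ x : L, x ≠ 0 → u x ≠ 0 := fun x hx => (Valuation.ne_zero_iff u).2 hx
  let H : AddSubgroup ℤ :=
    { carrier := {m | ∃ x : L, x ≠ 0 ∧ WithZero.log (u x) = m}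
      zero_mem' := ⟨1, one_ne_zero, by simp⟩
      add_mem' := by
        rintro a b ⟨x, hx, rfl⟩ ⟨y, hy, rfl⟩
        exact ⟨x * y, mul_ne_zero hx hy, by
          rw [map_mul, WithZero.log_mul (hu0 x hx) (hu0 y hy)]⟩
      neg_mem' := by
        rintro a ⟨x, hx, rfl⟩
        exact ⟨x⁻¹, inv_ne_zero hx, by rw [map_inv₀, WithZero.log_inv]⟩ }
  obtain ⟨g, hg⟩ := Int.subgroup_cyclic H
  have hmem : ∀ x : L, x ≠ 0 → WithZero.log (u x) ∈ H := fun x hx => ⟨x, hx, rfl⟩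
  have hlogz : WithZero.log (u z) < 0 := by
    rw [← WithZero.log_one, WithZero.log_lt_log (hu0 z hz) one_ne_zero]; exact huz
  have hdvd : ∀ m, m ∈ H ↔ g ∣ m := by
    intro m; rw [hg, AddSubgroup.mem_closure_singleton]
    constructor
    · rintro ⟨k, rfl⟩; simp
    · rintro ⟨k, rfl⟩; exact ⟨k, by simp [mul_comm]⟩
  have hg0 : g ≠ 0 := by
    rintro rfl
    have := (hdvd _).1 (hmem z hz)
    rw [zero_dvd_iff] at this
    omega
  obtain ⟨d, hd, hdd⟩ : ∃ d : ℤ, 0 < d ∧ ∀ m, m ∈ H ↔ d ∣ m :=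
    ⟨|g|, abs_pos.2 hg0, fun m => by rw [hdvd, abs_dvd]⟩
  have key : ∀ x : L, x ≠ 0 → ∃ k : ℤ, -WithZero.log (u x) / d = k ∧ WithZero.log (u x) = - (d * k) := by
    intro x hx
    obtain ⟨k, hk⟩ := (hdd _).1 (hmem x hx)
    refine ⟨-k, ?_, by rw [hk]; ring⟩
    rw [hk, ← mul_neg, Int.mul_ediv_cancel_left _ hd.ne']
  let v : L → WithTop ℤ := fun x => if x = 0 then ⊤ else ((-WithZero.log (u x) / d : ℤ) : WithTop ℤ)
  have hv : ∀ x : L, x ≠ 0 → ∃ k : ℤ, v x = k ∧ WithZero.log (u x) = - (d * k) := by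
    intro x hx
    obtain ⟨k, h1, h2⟩ := key x hx
    exact ⟨k, by simp [v, hx, h1], h2⟩
  have hv0 : v 0 = ⊤ := by simp [v]
  refine ⟨⟨v, ?_, ?_, ?_⟩, ?_, ?_, ?_⟩
  · intro x
    by_cases hx : x = 0
    · simp [hx, hv0]
    · obtain ⟨k, h1, -⟩ := hv x hx
      simp [h1, hx]
  · intro x y
    by_cases hx : x = 0
    · simp [hx, hv0]
    by_cases hy : y = 0
    · simp [hy, hv0]
    obtain ⟨k, h1, h1'⟩ := hv x hx
    obtain ⟨l, h2, h2'⟩ := hv y hy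
    obtain ⟨m, h3, h3'⟩ := hv (x * y) (mul_ne_zero hx hy)
    rw [map_mul, WithZero.log_mul (hu0 x hx) (hu0 y hy), h1', h2'] at h3'
    have : m = k + l := by
      have : d * m = d * (k + l) := by linarith
      exact mul_left_cancel₀ hd.ne' this
    rw [h1, h2, h3, this]; rfl
  · intro x y
    by_cases hx : x = 0
    · simp [hx, hv0]
    by_cases hy : y = 0
    · simp [hy, hv0]
    by_cases hxy : x + y = 0
    · simp [hxy, hv0]
    obtain ⟨k, h1, h1'⟩ := hv x hx
    obtain ⟨l, h2, h2'⟩ := hv y hy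
    obtain ⟨m, h3, h3'⟩ := hv (x + y) hxy
    have := u.map_add x y
    rw [h1, h2, h3, min_le_iff]
    rcases le_max_iff.1 this with h | h
    · left
      rw [← WithZero.log_le_log (hu0 _ hxy) (hu0 _ hx), h1', h3'] at h
      exact_mod_cast le_of_mul_le_mul_left (by linarith) hd
    · right
      rw [← WithZero.log_le_log (hu0 _ hxy) (hu0 _ hy), h2', h3'] at h
      exact_mod_cast le_of_mul_le_mul_left (by linarith) hd
  · obtain ⟨x, hx, hx'⟩ : -d ∈ H := (hdd _).2 (by simp)
    obtain ⟨k, h1, h1'⟩ := hv x hx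
    have : k = 1 := by
      have : d * k = d * 1 := by linarith
      exact mul_left_cancel₀ hd.ne' this
    exact ⟨x, by simp [h1, this]⟩
  · intro x h
    by_cases hx : x = 0
    · simp [hx, hv0]
    obtain ⟨k, h1, h1'⟩ := hv x hx
    rw [← WithZero.log_le_log (hu0 _ hx) one_ne_zero, h1', WithZero.log_one] at h
    have : 0 ≤ k := le_of_mul_le_mul_left (by linarith) hd
    simp only [h1]
    exact_mod_cast this
  · intro x h
    by_cases hx : x = 0
    · simp [hx, hv0]
    obtain ⟨k, h1, h1'⟩ := hv x hx
    rw [← WithZero.log_lt_log (hu0 _ hx) one_ne_zero, h1', WithZero.log_one] at h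
    have : 0 < k := lt_of_mul_lt_mul_left (by linarith) hd.le
    simp only [h1]
    exact_mod_cast this

theorem exists_val_dedekind {A K L : Type*} [CommRing A] [IsDedekindDomain A] [Field K] [Algebra A K]
    [IsFractionRing A K] [Field L] [Algebra K L] [FiniteDimensional K L] (z : A) (hz0 : z ≠ 0)
    (hz : ¬ IsUnit z) :
    ∃ u : Valuation L (WithZero (Multiplicative ℤ)),
      (∀ x : A, u (algebraMap K L (algebraMap A K x)) ≤ 1) ∧
      u (algebraMap K L (algebraMap A K z)) < 1 := by
  let S := separableClosure K L
  let : Algebra A S := ((algebraMap K S).comp (algebraMap A K)).toAlgebra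
  have : IsScalarTower A K S := IsScalarTower.of_algebraMap_eq (fun _ => rfl)
  have : IsDedekindDomain (integralClosure A S) := integralClosure.isDedekindDomain A K S
  let B := integralClosure A S
  have : IsFractionRing B S := integralClosure.isFractionRing_of_finite_extension K S
  have hinjK : Function.Injective (algebraMap A S) := by
    rw [IsScalarTower.algebraMap_eq A K S]
    exact (algebraMap K S).injective.comp (IsFractionRing.injective A K)
  have hinj : Function.Injective (algebraMap A B) := by
    have : algebraMap A S = (algebraMap B S).comp (algebraMap A B) := rfl
    intro x y h
    apply hinjK
    rw [this, RingHom.comp_apply, RingHom.comp_apply, h]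
  obtain ⟨M, hM, hzM⟩ := exists_max_ideal_of_mem_nonunits hz
  have : FaithfulSMul A B := (faithfulSMul_iff_algebraMap_injective A B).2 hinj
  have : M.IsPrime := hM.isPrime
  obtain ⟨Q, hQ, hQM⟩ := Ideal.exists_ideal_over_prime_of_isIntegral (S := B) M ⊥ (by
    rw [← RingHom.ker_eq_comap_bot, (RingHom.injective_iff_ker_eq_bot _).1 hinj]; exact bot_le)
  have hzQ : algebraMap A B z ∈ Q := by
    rw [← Ideal.mem_comap]
    rw [hQM.2]; exact hzM
  let P : IsDedekindDomain.HeightOneSpectrum B := ⟨Q, hQM.1, by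
    rintro rfl
    rw [Ideal.mem_bot] at hzQ
    exact hz0 (hinj (by rw [hzQ, map_zero]))⟩
  obtain ⟨p, hp⟩ := ExpChar.exists S
  let fr : L →+* S := IsPurelyInseparable.iterateFrobenius S L p le_rfl
  have hfr : ∀ x : A, fr (algebraMap K L (algebraMap A K x)) =
      (algebraMap B S (algebraMap A B x)) ^ p ^ (IsPurelyInseparable.exponent S L) := by
    intro x
    have : algebraMap K L (algebraMap A K x) = algebraMap S L (algebraMap B S (algebraMap A B x)) := rfl
    rw [this]
    exact IsPurelyInseparable.iterateFrobenius_algebraMap L p le_rfl _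
  refine ⟨(P.valuation S).comap fr, ?_, ?_⟩
  · intro x
    rw [Valuation.comap_apply, hfr, map_pow]
    exact pow_le_one₀ zero_le (P.valuation_le_one _)
  · rw [Valuation.comap_apply, hfr, map_pow]
    refine pow_lt_one₀ zero_le ((P.valuation_lt_one_iff_mem _).2 hzQ) ?_
    exact pow_ne_zero _ (expChar_pos S p).ne'

theorem AddVal.map_zero' {K : Type*} [Field K] (w : AddVal K) : w.v 0 = ⊤ := (w.eq_top_iff 0).2 rfl

theorem AddVal.map_one' {K : Type*} [Field K] (w : AddVal K) : w.v 1 = 0 := by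
  have h := w.map_mul 1 1
  have h1 : w.v 1 ≠ ⊤ := fun h => one_ne_zero ((w.eq_top_iff 1).1 h)
  lift w.v 1 to ℤ using h1 with k hk
  rw [one_mul, ← hk] at h
  have h : k = k + k := by exact_mod_cast h
  have : k = 0 := by omega
  simp [this]

theorem AddVal.inv_neg {K : Type*} [Field K] (w : AddVal K) (x : K) (hx : x ≠ 0) (h : 0 < w.v x) :
    w.v x⁻¹ < 0 := by
  have h2 := w.map_mul x x⁻¹
  rw [mul_inv_cancel₀ hx, w.map_one'] at h2
  have h1 : w.v x ≠ ⊤ := fun h => hx ((w.eq_top_iff x).1 h)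
  have h1' : w.v x⁻¹ ≠ ⊤ := fun h => inv_ne_zero hx ((w.eq_top_iff _).1 h)
  lift w.v x to ℤ using h1 with k hk
  lift w.v x⁻¹ to ℤ using h1' with l hl
  norm_cast at *
  omega

theorem AddVal.le_add {K : Type*} [Field K] (w : AddVal K) {x y : K} {m : WithTop ℤ}
    (hx : m ≤ w.v x) (hy : m ≤ w.v y) : m ≤ w.v (x + y) :=
  (le_min hx hy).trans (w.add_le x y)

theorem AddVal.map_pow' {K : Type*} [Field K] (w : AddVal K) (x : K) (n : ℕ) :
    w.v (x ^ n) = n • w.v x := by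
  induction n with
  | zero => simp [w.map_one']
  | succ n ih => rw [pow_succ, w.map_mul, ih, succ_nsmul]

theorem AddVal.map_neg' {K : Type*} [Field K] (w : AddVal K) (x : K) : w.v (-x) = w.v x := by
  have h : w.v (-1) = 0 := by
    have h := w.map_mul (-1) (-1)
    have h1 : w.v (-1) ≠ ⊤ := fun h => by simpa using ((w.eq_top_iff (-1)).1 h)
    lift w.v (-1) to ℤ using h1 with k hk
    rw [neg_one_mul, neg_neg, w.map_one'] at h
    norm_cast at *
    omega
  rw [← neg_one_mul, w.map_mul, h, zero_add]

theorem AddVal.le_sub {K : Type*} [Field K] (w : AddVal K) {x y : K} {m : WithTop ℤ}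
    (hx : m ≤ w.v x) (hy : m ≤ w.v y) : m ≤ w.v (x - y) := by
  rw [sub_eq_add_neg]
  exact w.le_add hx (by rwa [w.map_neg'])

theorem AddVal.le_sum {K ι : Type*} [Field K] (w : AddVal K) {m : WithTop ℤ} (s : Finset ι) (f : ι → K)
    (h : ∀ i ∈ s, m ≤ w.v (f i)) : m ≤ w.v (∑ i ∈ s, f i) := by
  refine Finset.sum_induction f (fun x => m ≤ w.v x) (fun _ _ => w.le_add) ?_ h
  rw [w.map_zero']; exact le_top

theorem le_ordv_iff {K : Type*} [Field K] (w : AddVal K) (h : Polynomial K) (m : WithTop ℤ) :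
    m ≤ ordv w h ↔ ∀ i, m ≤ w.v (h.coeff i) := by
  rw [ordv, Finset.le_inf_iff]
  constructor
  · intro H i
    by_cases hi : i < h.natDegree + 1
    · exact H i (Finset.mem_range.2 hi)
    · rw [Polynomial.coeff_eq_zero_of_natDegree_lt (by omega), w.map_zero']; exact le_top
  · intro H i _
    exact H i

section places
variable {Fq L : Type*} [Field Fq] [Field L] [Algebra (RatFunc Fq) L]

open scoped IntermediateField.algebraAdjoinAdjoin in
theorem exists_place_pos [FiniteDimensional (RatFunc Fq) L]
    [Algebra Fq L] [IsScalarTower Fq (RatFunc Fq) L] (z : L) (hz : Transcendental Fq z) :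
    ∃ w : Place Fq L, 0 < w.v z := by
  have : FiniteDimensional (IntermediateField.adjoin Fq {z}) L :=
    FunctionField.finiteDimensional_of_adjoin_transcendental hz
  let A := Algebra.adjoin Fq ({z} : Set L)
  let e : Polynomial Fq ≃ₐ[Fq] A := AlgEquiv.ofInjective (Polynomial.aeval z) (transcendental_iff_injective.1 hz)
    |>.trans (Subalgebra.equivOfEq _ _ (Algebra.adjoin_singleton_eq_range_aeval Fq z).symm)
  have : IsPrincipalIdealRing A := IsPrincipalIdealRing.of_surjective e.toRingEquiv.toRingHom e.surjective
  have : IsDedekindDomain A := inferInstance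
  have hfr : IsFractionRing A (IntermediateField.adjoin Fq {z}) :=
    inferInstance
  let zA : A := ⟨z, Algebra.subset_adjoin rfl⟩
  have hzA : e Polynomial.X = zA := by
    apply Subtype.ext
    simp [e, zA]
  have h0 : zA ≠ 0 := by
    rw [← hzA]; simp
  have hu : ¬ IsUnit zA := by
    rw [← hzA, MulEquiv.isUnit_map]
    exact Polynomial.not_isUnit_X
  obtain ⟨u, hu1, hu2⟩ := exists_val_dedekind (K := IntermediateField.adjoin Fq {z}) (L := L) zA h0 hu
  have hu2 : u z < 1 := hu2
  have hz0 : z ≠ 0 := fun h => h0 (Subtype.ext h)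
  have hc : ∀ c : Fq, u (algebraMap Fq L c) ≤ 1 := fun c => hu1 (algebraMap Fq A c)
  obtain ⟨w, hw1, hw2, hw3⟩ := norm_addval u z hz0 hu2
  refine ⟨⟨w, ?_, hw1⟩, hw3 z hu2⟩
  intro c hc0
  rw [← IsScalarTower.algebraMap_apply]
  have hc0' : algebraMap Fq L c ≠ 0 := by simpa using hc0
  refine le_antisymm ?_ (hw2 _ (hc c))
  by_contra h
  push Not at h
  have h4 := w.inv_neg _ hc0' h
  rw [← map_inv₀] at h4
  exact absurd (hw2 _ (hc c⁻¹)) (not_le.2 h4)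

theorem const_nonneg [Algebra Fq L] [IsScalarTower Fq (RatFunc Fq) L] (w : Place Fq L) (c : Fq) :
    0 ≤ w.v (algebraMap Fq L c) := by
  by_cases hc : c = 0
  · rw [hc, map_zero, w.map_zero']; exact le_top
  · rw [IsScalarTower.algebraMap_apply Fq (RatFunc Fq) L, w.const_zero c hc]

theorem eq_zero_of_places [FiniteDimensional (RatFunc Fq) L]
    (c : L) (hfin : ∀ w : Place Fq L, 0 ≤ w.v (thetaL Fq L) → 0 ≤ w.v c)
    (hinf : ∀ w : Place Fq L, w.v (thetaL Fq L) < 0 → 0 < w.v c) : c = 0 := by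
  let : Algebra Fq L := (constMap Fq L).toAlgebra
  have : IsScalarTower Fq (RatFunc Fq) L := IsScalarTower.of_algebraMap_eq (fun _ => rfl)
  by_contra hc
  by_cases ht : Transcendental Fq c
  · have ht' : Transcendental Fq c⁻¹ := fun h => ht (by simpa using h.inv)
    obtain ⟨w, hw⟩ := exists_place_pos _ ht'
    have := w.inv_neg _ (inv_ne_zero hc) hw
    rw [inv_inv] at this
    rcases lt_or_ge (w.v (thetaL Fq L)) 0 with h | h
    · exact absurd (hinf w h) (not_lt.2 this.le)
    · exact absurd (hfin w h) (not_le.2 this)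
  · have ht : IsAlgebraic Fq c := by simpa [Transcendental] using ht
    have hth : Transcendental Fq (thetaL Fq L) :=
      (transcendental_algebraMap_iff (algebraMap (RatFunc Fq) L).injective).2 RatFunc.transcendental_X
    have hth' : Transcendental Fq (thetaL Fq L)⁻¹ := fun h => hth (by simpa using h.inv)
    have hth0 : thetaL Fq L ≠ 0 := by
      intro h; apply hth; rw [h]; exact isAlgebraic_zero
    obtain ⟨w, hw⟩ := exists_place_pos _ hth'
    have := w.inv_neg _ (inv_ne_zero hth0) hw
    rw [inv_inv] at this
    have hpos := hinf w this
    have hneg := w.inv_neg _ hc hpos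
    have hmem : c⁻¹ ∈ Algebra.adjoin Fq ({c} : Set L) := by
      have : c ∈ Algebra.adjoin Fq ({c} : Set L) := Algebra.subset_adjoin rfl
      exact Subalgebra.inv_mem_of_algebraic _ (x := ⟨c, this⟩) ht
    have : 0 ≤ w.v c⁻¹ := by
      refine Algebra.adjoin_induction (p := fun x _ => 0 ≤ w.v x) ?_ ?_ ?_ ?_ hmem
      · rintro x rfl; exact hpos.le
      · exact const_nonneg w
      · intro x y _ _; exact w.le_add
      · intro x y _ _ hx hy; rw [w.map_mul]; exact add_nonneg hx hy
    exact absurd this (not_le.2 hneg)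

end places

noncomputable def DD {L : Type*} [Field L] (n : ℕ) (θ : L) (φ : L →+* L) : Polynomial L →+ Polynomial L where
  toFun h := (Polynomial.X - Polynomial.C θ) ^ n * h - h.map φ
  map_zero' := by simp
  map_add' x y := by rw [Polynomial.map_add]; ring

theorem DD_apply {L : Type*} [Field L] (n : ℕ) (θ : L) (φ : L →+* L) (h : Polynomial L) :
    DD n θ φ h = (Polynomial.X - Polynomial.C θ) ^ n * h - h.map φ := rfl

theorem DD_mul {L : Type*} [Field L] (n : ℕ) (θ : L) (φ : L →+* L) (b h : Polynomial L)
    (hb : b.map φ = b) : b * DD n θ φ h = DD n θ φ (b * h) := by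
  rw [DD_apply, DD_apply, Polynomial.map_mul, hb]; ring

theorem assocPoly_sum {L ι : Type*} [Field L] (n : ℕ) (θ : L) (s : Finset ι) (c : ι → L)
    (Q : ι → Fin n → L) : assocPoly n θ (∑ i ∈ s, c i • Q i) =
      ∑ i ∈ s, Polynomial.C (c i) * assocPoly n θ (Q i) := by
  simp only [assocPoly, Finset.mul_sum]
  rw [Finset.sum_comm]
  refine Finset.sum_congr rfl fun j _ => ?_
  rw [Finset.sum_apply, map_sum, Finset.sum_mul]
  refine Finset.sum_congr rfl fun i _ => ?_
  rw [Pi.smul_apply, smul_eq_mul, Polynomial.C_mul, mul_assoc]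

theorem assocPoly_step {L : Type*} [Field L] (q m : ℕ) (θ : L) (φ : L →+* L) (hφ : ∀ x, φ x = x ^ q)
    (x : Fin (m + 1) → L) :
    Polynomial.X * assocPoly (m + 1) θ x - assocPoly (m + 1) θ (carlitzPhi q (m + 1) θ x) =
      DD (m + 1) θ φ (Polynomial.C (x 0)) := by
  have h1 : (Polynomial.X - Polynomial.C θ) * assocPoly (m + 1) θ x =
      ∑ i : Fin m, Polynomial.C (x i.castSucc.rev) * (Polynomial.X - Polynomial.C θ) ^ ((i : ℕ) + 1)
        + Polynomial.C (x 0) * (Polynomial.X - Polynomial.C θ) ^ (m + 1) := by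
    rw [assocPoly, Finset.mul_sum, Fin.sum_univ_castSucc]
    congr 1
    · refine Finset.sum_congr rfl fun i _ => ?_
      simp only [Fin.val_castSucc]; ring
    · simp only [Fin.rev_last, Fin.val_last]; ring
  have h2 : assocPoly (m + 1) θ (carlitzPhi q (m + 1) θ x) =
      Polynomial.C θ * assocPoly (m + 1) θ x + Polynomial.C (x 0 ^ q) +
      ∑ i : Fin m, Polynomial.C (x i.castSucc.rev) * (Polynomial.X - Polynomial.C θ) ^ ((i : ℕ) + 1) := by
    have e1 : carlitzPhi q (m + 1) θ x (Fin.rev 0) = θ * x (Fin.rev 0) + x 0 ^ q := by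
      simp [carlitzPhi]
    have e2 : ∀ i : Fin m, carlitzPhi q (m + 1) θ x (Fin.rev i.succ) =
        θ * x (Fin.rev i.succ) + x i.castSucc.rev := by
      intro i
      have hi := i.isLt
      have hlt : ((Fin.rev i.succ : Fin (m + 1)) : ℕ) + 1 < m + 1 := by
        simp only [Fin.val_rev, Fin.val_succ]; omega
      rw [carlitzPhi, dif_pos hlt]
      congr 2
      apply Fin.ext
      simp only [Fin.val_rev, Fin.val_succ, Fin.val_castSucc]; omega
    rw [assocPoly, assocPoly, Fin.sum_univ_succ, Fin.sum_univ_succ, e1]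
    simp only [e2, Polynomial.C_add, Polynomial.C_mul, add_mul, Finset.sum_add_distrib, mul_add,
      Finset.mul_sum, Fin.val_succ, Fin.val_zero, pow_zero, mul_one, mul_assoc]
    ring
  have h3 : Polynomial.X * assocPoly (m + 1) θ x = (Polynomial.X - Polynomial.C θ) * assocPoly (m + 1) θ x
      + Polynomial.C θ * assocPoly (m + 1) θ x := by ring
  rw [h3, h1, h2, DD_apply, Polynomial.map_C, hφ]
  ring

theorem assocPoly_iter {L : Type*} [Field L] (q m : ℕ) (θ : L) (φ : L →+* L) (hφ : ∀ x, φ x = x ^ q)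
    (x : Fin (m + 1) → L) (k : ℕ) :
    Polynomial.X ^ k * assocPoly (m + 1) θ x - assocPoly (m + 1) θ ((carlitzPhi q (m + 1) θ)^[k] x) ∈
      (DD (m + 1) θ φ).range := by
  induction k with
  | zero => simp
  | succ k ih =>
    obtain ⟨h, hh⟩ := ih
    rw [Function.iterate_succ_apply']
    set y := (carlitzPhi q (m + 1) θ)^[k] x
    refine ⟨Polynomial.X * h + Polynomial.C (y 0), ?_⟩
    rw [map_add, ← assocPoly_step q m θ φ hφ, ← DD_mul _ _ _ _ _ (Polynomial.map_X φ), hh]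
    ring

theorem assocPoly_act {Fq L : Type*} [Field Fq] [Field L] (q m : ℕ) (θ : L) (χ : Fq →+* L)
    (φ : L →+* L) (hφ : ∀ x, φ x = x ^ q) (hχ : ∀ c, φ (χ c) = χ c) (a : Polynomial Fq)
    (x : Fin (m + 1) → L) :
    a.map χ * assocPoly (m + 1) θ x - assocPoly (m + 1) θ (carlitzAct q (m + 1) θ χ a x) ∈
      (DD (m + 1) θ φ).range := by
  have h1 : a.map χ = ∑ i ∈ Finset.range (a.natDegree + 1), Polynomial.C (χ (a.coeff i)) * Polynomial.X ^ i := by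
    conv_lhs => rw [a.as_sum_range_C_mul_X_pow]
    simp [Polynomial.map_sum]
  rw [carlitzAct, assocPoly_sum, h1, Finset.sum_mul, ← Finset.sum_sub_distrib]
  refine sum_mem fun i _ => ?_
  obtain ⟨h, hh⟩ := assocPoly_iter q m θ φ hφ x i
  refine ⟨Polynomial.C (χ (a.coeff i)) * h, ?_⟩
  rw [← DD_mul _ _ _ _ _ (by rw [Polynomial.map_C, hχ]), hh]
  ring

theorem coeff_mul_nonneg {L : Type*} [Field L] (w : AddVal L) (m : WithTop ℤ) (b f : Polynomial L)
    (hb : ∀ i, 0 ≤ w.v (b.coeff i)) (hf : ∀ i, m ≤ w.v (f.coeff i)) (i : ℕ) :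
    m ≤ w.v ((b * f).coeff i) := by
  rw [Polynomial.coeff_mul]
  refine w.le_sum _ _ fun j _ => ?_
  rw [w.map_mul]
  simpa using add_le_add (hb j.1) (hf j.2)

theorem theta_pow_nonneg {L : Type*} [Field L] (w : AddVal L) (θ : L) (hθ : 0 ≤ w.v θ) (n : ℕ) :
    ∀ i, 0 ≤ w.v (((Polynomial.X - Polynomial.C θ) ^ n).coeff i) := by
  have h1 : ∀ i, 0 ≤ w.v ((1 : Polynomial L).coeff i) := by
    intro i
    rw [Polynomial.coeff_one]
    split_ifs
    · rw [w.map_one']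
    · rw [w.map_zero']; exact le_top
  induction n with
  | zero => simpa using h1
  | succ n ih =>
    rw [pow_succ]
    refine coeff_mul_nonneg w 0 _ _ ih ?_
    intro i
    rw [Polynomial.coeff_sub, Polynomial.coeff_X, Polynomial.coeff_C]
    refine w.le_sub ?_ ?_ <;> split_ifs <;> simp [w.map_zero', w.map_one', hθ]

theorem finite_place_bound {L : Type*} [Field L] (w : AddVal L) (q : ℕ) (hq : 2 ≤ q) (n : ℕ) (θ : L)
    (hθ : 0 ≤ w.v θ) (φ : L →+* L) (hφ : ∀ x, φ x = x ^ q) (h : Polynomial L)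
    (hF : ∀ i, ((1 - (q : ℤ) : ℤ) : WithTop ℤ) ≤ w.v ((DD n θ φ h).coeff i)) (i : ℕ) :
    0 ≤ w.v (h.coeff i) := by
  obtain ⟨j, -, hj⟩ := Finset.exists_min_image (Finset.range (h.natDegree + 1)) (fun i => w.v (h.coeff i))
    ⟨0, by simp⟩
  have hj' : ∀ i, w.v (h.coeff j) ≤ w.v (h.coeff i) := by
    intro i
    by_cases hi : i < h.natDegree + 1
    · exact hj i (Finset.mem_range.2 hi)
    · rw [Polynomial.coeff_eq_zero_of_natDegree_lt (n := i) (by omega), w.map_zero']; exact le_top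
  refine le_trans ?_ (hj' i)
  by_contra hneg
  push Not at hneg
  have h1 := coeff_mul_nonneg w _ _ h (theta_pow_nonneg w θ hθ n) hj' j
  have h2 : (h.coeff j) ^ q = ((Polynomial.X - Polynomial.C θ) ^ n * h).coeff j - (DD n θ φ h).coeff j := by
    rw [DD_apply, Polynomial.coeff_sub, Polynomial.coeff_map, hφ]; ring
  have h3 := w.le_sub (min_le_of_left_le h1) (min_le_of_right_le (hF j))
  rw [← h2, w.map_pow', min_le_iff] at h3
  have hne : w.v (h.coeff j) ≠ ⊤ := hneg.ne_top
  lift w.v (h.coeff j) to ℤ using hne with k hk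
  have hk0 : k < 0 := by exact_mod_cast hneg
  have h3' : k ≤ q * k ∨ 1 - (q : ℤ) ≤ q * k := by
    rcases h3 with h3 | h3
    · left
      rw [← WithTop.coe_nsmul] at h3
      simpa using WithTop.coe_le_coe.1 h3
    · right
      rw [← WithTop.coe_nsmul] at h3
      simpa using WithTop.coe_le_coe.1 h3
  have hq' : (2 : ℤ) ≤ q := by exact_mod_cast hq
  rcases h3' with h | h <;> nlinarith

theorem DD_lead {L : Type*} [Field L] (n : ℕ) (hn : 1 ≤ n) (θ : L) (φ : L →+* L) (h : Polynomial L) :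
    (DD n θ φ h).coeff (n + h.natDegree) = h.leadingCoeff := by
  rw [DD_apply, Polynomial.coeff_sub, Polynomial.coeff_map,
    Polynomial.coeff_eq_zero_of_natDegree_lt (p := h) (by omega), map_zero, sub_zero]
  have hm : ((Polynomial.X - Polynomial.C θ) ^ n).Monic := (Polynomial.monic_X_sub_C θ).pow n
  have hd : ((Polynomial.X - Polynomial.C θ) ^ n).natDegree = n := by
    rw [Polynomial.natDegree_pow, Polynomial.natDegree_X_sub_C, mul_one]
  have := Polynomial.coeff_mul_degree_add_degree ((Polynomial.X - Polynomial.C θ) ^ n) h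
  rw [hd, hm.leadingCoeff, one_mul] at this
  exact this

/-- Sufficient conditions on the associated polynomials `f_{P_i}` for the points
`P_1,…,P_ℓ` of `C^{⊗n}(L)` to be linearly independent over `𝔽_q[t]`. -/
theorem carlitz_points_linearly_independent
    (p q e : ℕ) (hp : p.Prime) (he : 0 < e) (hq : q = p ^ e)
    (Fq : Type*) [Field Fq] [Fintype Fq] (hFq : Fintype.card Fq = q)
    (L : Type*) [Field L] [Algebra (RatFunc Fq) L] [FiniteDimensional (RatFunc Fq) L]
    (n : ℕ) (hn : 1 ≤ n) (ℓ : ℕ) (P : Fin ℓ → Fin n → L)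
    (hindep : ∀ b : Fin ℓ → Polynomial Fq,
      ∑ i : Fin ℓ, ((b i).map (constMap Fq L)) * assocPoly n (thetaL Fq L) (P i) = 0 →
        ∀ i, b i = 0)
    (hinf : ∀ w : Place Fq L, w.v (thetaL Fq L) < 0 →
      ∀ i, 0 < ordv w.toAddVal (assocPoly n (thetaL Fq L) (P i)))
    (hfin : ∀ w : Place Fq L, 0 ≤ w.v (thetaL Fq L) →
      ∀ i, ((1 - (q : ℤ) : ℤ) : WithTop ℤ) ≤ ordv w.toAddVal (assocPoly n (thetaL Fq L) (P i)))
    (a : Fin ℓ → Polynomial Fq)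
    (ha : ∑ i : Fin ℓ, carlitzAct q n (thetaL Fq L) (constMap Fq L) (a i) (P i) = 0) :
    ∀ i, a i = 0 := by
  have hp' : Fact p.Prime := ⟨hp⟩
  have hcp : CharP Fq p := by
    have hcard : (Fintype.card Fq : Fq) = 0 := Nat.cast_card_eq_zero Fq
    rw [hFq, hq, Nat.cast_pow] at hcard
    have hp0 : (p : Fq) = 0 := eq_zero_of_pow_eq_zero hcard
    exact (CharP.charP_iff_prime_eq_zero hp).2 hp0
  have hcpL : CharP L p := charP_of_injective_ringHom (constMap Fq L).injective p
  have hq2 : 2 ≤ q := by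
    rw [← hFq]; exact Fintype.one_lt_card
  obtain ⟨m, rfl⟩ : ∃ m, n = m + 1 := ⟨n - 1, by omega⟩
  let φ : L →+* L := iterateFrobenius L p e
  have hφ : ∀ x, φ x = x ^ q := fun x => by rw [hq]; exact iterateFrobenius_def ..
  have hχ : ∀ c, φ (constMap Fq L c) = constMap Fq L c := fun c => by
    rw [hφ, ← map_pow, ← hFq, FiniteField.pow_card]
  have hmem : ∑ i : Fin ℓ, ((a i).map (constMap Fq L)) * assocPoly (m + 1) (thetaL Fq L) (P i) ∈
      (DD (m + 1) (thetaL Fq L) φ).range := by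
    have h1 : ∑ i : Fin ℓ, assocPoly (m + 1) (thetaL Fq L)
        (carlitzAct q (m + 1) (thetaL Fq L) (constMap Fq L) (a i) (P i)) = 0 := by
      have := assocPoly_sum (m + 1) (thetaL Fq L) Finset.univ (fun _ => (1 : L))
        (fun i : Fin ℓ => carlitzAct q (m + 1) (thetaL Fq L) (constMap Fq L) (a i) (P i))
      simp only [one_smul, ha, Polynomial.C_1, one_mul] at this
      rw [← this]
      simp [assocPoly]
    rw [← sub_zero (∑ i : Fin ℓ, _), ← h1, ← Finset.sum_sub_distrib]
    exact sum_mem fun i _ => assocPoly_act q m _ _ φ hφ hχ (a i) (P i)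
  obtain ⟨h, hh⟩ := hmem
  have hval : ∀ (w : Place Fq L) (k : WithTop ℤ),
      (∀ i, k ≤ ordv w.toAddVal (assocPoly (m + 1) (thetaL Fq L) (P i))) →
      ∀ j, k ≤ w.v ((DD (m + 1) (thetaL Fq L) φ h).coeff j) := by
    intro w k hk j
    rw [hh, Polynomial.finsetSum_coeff]
    refine w.le_sum _ _ fun i _ => ?_
    refine coeff_mul_nonneg w.toAddVal k _ _ ?_ ((le_ordv_iff _ _ _).1 (hk i)) j
    intro s
    rw [Polynomial.coeff_map]
    by_cases hc : (a i).coeff s = 0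
    · rw [hc, map_zero, w.map_zero']; exact le_top
    · exact (w.const_zero _ hc).ge
  have hlead : h.leadingCoeff = 0 := by
    apply eq_zero_of_places (Fq := Fq)
    · intro w hw
      exact finite_place_bound w.toAddVal q hq2 (m + 1) _ hw φ hφ h (hval w _ (hfin w hw)) _
    · intro w hw
      rw [← DD_lead (m + 1) hn (thetaL Fq L) φ h]
      have h1 : ∀ x : WithTop ℤ, 0 < x ↔ 1 ≤ x := by
        intro x
        induction x using WithTop.recTopCoe with
        | top => simp
        | coe x =>
          norm_cast
      rw [h1]
      exact hval w 1 (fun i => (h1 _).1 (hinf w hw i)) _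
  rw [Polynomial.leadingCoeff_eq_zero] at hlead
  rw [hlead, map_zero] at hh
  exact hindep a hh.symm
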